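/- arXiv:1712.01418 — 2 statements merged into one kernel-verified Lean document; each statement's English description precedes it below -/
import Mathlib

section
/- Let pav(n) be the number of orbits of transitive triples of fixed-point-free involutions on Fin n under simultaneous conjugation by Sym(Fin n) (equivalently, by the preceding correspondence, the number of conjugacy classes of free subgroups of index n in ℤ/2 * ℤ/2 * ℤ/2). Then pav(n) = 0 for odd n, and pav(2k) is asymptotically equivalent to √(2/π)·(2/e)^k·k^{k−1/2}; that is, pav(2k)/(√(2/π)·(2/e)^k·k^{k−1/2}) tends to 1 as k → ∞. -/
open Filter

/-- A fixed-point-free involution: a permutation `σ` with `σ ∘ σ = id` and no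
fixed point. -/
def IsFPFInvolution {D : Type*} (σ : Equiv.Perm D) : Prop :=
  σ * σ = 1 ∧ ∀ x, σ x ≠ x

/-- A transitive triple on `Fin n`: a triple of fixed-point-free involutions
generating a subgroup that acts transitively on `Fin n`. -/
def IsTransitiveTriple {n : ℕ}
    (t : Equiv.Perm (Fin n) × Equiv.Perm (Fin n) × Equiv.Perm (Fin n)) : Prop :=
  (IsFPFInvolution t.1 ∧ IsFPFInvolution t.2.1 ∧ IsFPFInvolution t.2.2) ∧
    ∀ x y : Fin n, ∃ g ∈ Subgroup.closure ({t.1, t.2.1, t.2.2} :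
      Set (Equiv.Perm (Fin n))), g x = y

/-- Simultaneous conjugation of transitive triples by a permutation of `Fin n`. -/
def pavRel (n : ℕ)
    (t s : {t : Equiv.Perm (Fin n) × Equiv.Perm (Fin n) × Equiv.Perm (Fin n) //
      IsTransitiveTriple t}) : Prop :=
  ∃ π : Equiv.Perm (Fin n),
    π * t.1.1 * π⁻¹ = s.1.1 ∧ π * t.1.2.1 * π⁻¹ = s.1.2.1 ∧
      π * t.1.2.2 * π⁻¹ = s.1.2.2

/-- `pav(n)`: the number of isomorphism classes of connected pavings on `n`
darts, i.e. of orbits of transitive triples under simultaneous conjugation. -/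
noncomputable def pav (n : ℕ) : ℕ := Nat.card (Quot (pavRel n))

/-- A permutation is semiregular if each of its powers with a fixed point is the identity. -/
def IsSemiregular {D : Type*} (σ : Equiv.Perm D) : Prop :=
  ∀ (i : ℕ) (x : D), (σ ^ i) x = x → σ ^ i = 1

lemma IsSemiregular.cycleType_eq {D : Type*} [Fintype D] [DecidableEq D] {σ : Equiv.Perm D}
    (h : IsSemiregular σ) (h1 : σ ≠ 1) :
    orderOf σ * (Fintype.card D / orderOf σ) = Fintype.card D ∧
      σ.cycleType = Multiset.replicate (Fintype.card D / orderOf σ) (orderOf σ) := by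
  have hall : ∀ n ∈ σ.cycleType, n = orderOf σ := by
    intro n hn
    refine Nat.dvd_antisymm (Equiv.Perm.dvd_of_mem_cycleType hn) ?_
    obtain ⟨c, τ, rfl, hd, hc, rfl⟩ := Equiv.Perm.mem_cycleType_iff.1 hn
    obtain ⟨x, hx⟩ := hc.nonempty_support
    refine orderOf_dvd_of_pow_eq_one (h _ x ?_)
    have hτ : τ x = x := (hd x).resolve_left (Equiv.Perm.mem_support.1 hx)
    rw [hd.commute.mul_pow, Equiv.Perm.mul_apply, Equiv.Perm.pow_apply_eq_self_of_apply_eq_self hτ,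
      ← hc.orderOf, pow_orderOf_eq_one, Equiv.Perm.one_apply]
  have hsupp : σ.support = Finset.univ := by
    ext x
    simp only [Equiv.Perm.mem_support, Finset.mem_univ, iff_true]
    intro hx
    exact h1 (by simpa using h 1 x (by simpa using hx))
  have hrep := Multiset.eq_replicate_of_mem hall
  have hsum := σ.sum_cycleType
  rw [hrep, hsupp, Multiset.sum_replicate, smul_eq_mul, Finset.card_univ] at hsum
  have hpos : 0 < orderOf σ := orderOf_pos σ
  have hcard : Fintype.card D / orderOf σ = σ.cycleType.card := by
    rw [← hsum, Nat.mul_div_cancel _ hpos]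
  rw [hcard]
  exact ⟨by rw [mul_comm, hsum], hrep⟩

/-- The number of permutations of `D` that are products of `m` disjoint cycles of length `d`. -/
lemma card_cycleType_replicate {D : Type*} [Fintype D] [DecidableEq D] {m d : ℕ} (hd : 2 ≤ d)
    (hm : d * m = Fintype.card D) :
    (Finset.univ.filter fun g : Equiv.Perm D => g.cycleType = Multiset.replicate m d).card *
      (d ^ m * m.factorial) = (Fintype.card D).factorial := by
  have h := Equiv.Perm.card_of_cycleType_mul_eq D (Multiset.replicate m d)
  have hc : (Multiset.replicate m d).sum ≤ Fintype.card D ∧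
      ∀ a ∈ Multiset.replicate m d, 2 ≤ a := by
    refine ⟨by rw [Multiset.sum_replicate, smul_eq_mul, mul_comm, hm], fun a ha => ?_⟩
    rwa [Multiset.eq_of_mem_replicate ha]
  rw [if_pos hc] at h
  rw [← h]
  congr 1
  rcases Nat.eq_zero_or_pos m with rfl | hpos
  · simp at hm
    simp [← hm]
  · rw [Multiset.toFinset_replicate, if_neg hpos.ne', Finset.prod_singleton,
      Multiset.count_replicate_self, Multiset.prod_replicate, Multiset.sum_replicate,
      smul_eq_mul, mul_comm m d, hm, Nat.sub_self, Nat.factorial_zero, one_mul]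

lemma IsFPFInvolution.pow_eq {D : Type*} {σ : Equiv.Perm D} (h : IsFPFInvolution σ) (i : ℕ) :
    σ ^ i = 1 ∨ σ ^ i = σ := by
  rcases Nat.even_or_odd' i with ⟨j, rfl | rfl⟩
  · left; rw [pow_mul, pow_two, h.1, one_pow]
  · right; rw [pow_succ, pow_mul, pow_two, h.1, one_pow, one_mul]

lemma IsFPFInvolution.isSemiregular {D : Type*} {σ : Equiv.Perm D} (h : IsFPFInvolution σ) :
    IsSemiregular σ := by
  intro i x hx
  rcases h.pow_eq i with hi | hi
  · exact hi
  · exact absurd (hi ▸ hx) (h.2 x)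

lemma isFPFInvolution_iff_cycleType {D : Type*} [Fintype D] [DecidableEq D] {k : ℕ}
    (hk : 2 * k = Fintype.card D) (σ : Equiv.Perm D) :
    IsFPFInvolution σ ↔ σ.cycleType = Multiset.replicate k 2 := by
  constructor
  · intro h
    rcases isEmpty_or_nonempty D with hD | ⟨⟨x⟩⟩
    · have : k = 0 := by simpa using hk
      subst this
      simp [Subsingleton.elim σ 1]
    · have h1 : σ ≠ 1 := fun h1 => h.2 x (by simp [h1])
      have h2 : orderOf σ = 2 := orderOf_eq_prime (by rw [pow_two, h.1]) h1
      have := (h.isSemiregular.cycleType_eq h1).2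
      rwa [h2, ← hk, Nat.mul_div_cancel_left _ two_pos] at this
  · intro h
    have h2 : σ ^ 2 = 1 := by
      refine orderOf_dvd_iff_pow_eq_one.1 ?_
      rw [← Equiv.Perm.lcm_cycleType, h, Multiset.lcm_dvd]
      intro b hb
      rw [Multiset.eq_of_mem_replicate hb]
    have hsupp : σ.support = Finset.univ := by
      rw [← Finset.card_eq_iff_eq_univ, ← Equiv.Perm.sum_cycleType, h, Multiset.sum_replicate,
        smul_eq_mul, mul_comm, hk]
    exact ⟨by rw [← pow_two, h2], fun x => Equiv.Perm.mem_support.1 (hsupp ▸ Finset.mem_univ x)⟩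

/-- The number of fixed-point-free involutions of a type with `n` elements. -/
noncomputable def fpfCount (n : ℕ) : ℕ := Nat.card {σ : Equiv.Perm (Fin n) // IsFPFInvolution σ}

lemma card_isFPFInvolution (D : Type*) [Fintype D] :
    Nat.card {σ : Equiv.Perm D // IsFPFInvolution σ} = fpfCount (Fintype.card D) := by
  set e := Fintype.equivFin D
  refine Nat.card_congr (e.permCongr.subtypeEquiv fun σ => and_congr ?_ ?_)
  · rw [← Equiv.permCongr_mul]
    exact (map_eq_one_iff e.permCongrHom e.permCongrHom.injective).symm
  · simp only [Equiv.permCongr_apply, ne_eq, e.symm.forall_congr_left, Equiv.symm_symm]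
    exact forall_congr' fun x => not_congr (by simp)

lemma fpfCount_two_mul (k : ℕ) : fpfCount (2 * k) * (2 ^ k * k.factorial) = (2 * k).factorial := by
  classical
  have h := card_cycleType_replicate (D := Fin (2 * k)) (m := k) le_rfl (by simp)
  rw [Fintype.card_fin] at h
  rw [← h, fpfCount, Nat.card_eq_fintype_card, Fintype.card_subtype]
  simp_rw [isFPFInvolution_iff_cycleType (D := Fin (2 * k)) (k := k) (by simp)]

lemma IsFPFInvolution.even_card {D : Type*} [Fintype D] {σ : Equiv.Perm D}
    (h : IsFPFInvolution σ) : Even (Fintype.card D) := by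
  classical
  rcases isEmpty_or_nonempty D with hD | ⟨⟨x⟩⟩
  · simp
  have h1 : σ ≠ 1 := fun h1 => h.2 x (by simp [h1])
  have h2 : orderOf σ = 2 := orderOf_eq_prime (by rw [pow_two, h.1]) h1
  have := (h.isSemiregular.cycleType_eq h1).1
  rw [h2] at this
  exact ⟨_, by rw [← two_mul, this]⟩

lemma fpfCount_of_odd {n : ℕ} (hn : Odd n) : fpfCount n = 0 := by
  rw [fpfCount, Nat.card_eq_zero]
  left
  refine ⟨fun ⟨σ, h⟩ => ?_⟩
  have := h.even_card
  rw [Fintype.card_fin] at this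
  exact Nat.not_even_iff_odd.2 hn this

lemma card_involutive_sq_le (Q : Type*) [Fintype Q] :
    (Nat.card {f : Q → Q // Function.Involutive f}) ^ 2 ≤
      4 ^ Fintype.card Q * Fintype.card Q ^ Fintype.card Q := by
  classical
  let _ : LinearOrder Q := LinearOrder.lift' (Fintype.equivFin Q) (Fintype.equivFin Q).injective
  set m := Fintype.card Q with hm
  set S : Finset (Q → Q) := Finset.univ.filter Function.Involutive with hS
  let A : (Q → Q) → Finset Q := fun f => Finset.univ.filter fun x => x < f x
  have hfib : ∀ B : Finset Q, (S.filter fun f => A f = B).card ≤ m ^ (m / 2) := by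
    intro B
    rcases (S.filter fun f => A f = B).eq_empty_or_nonempty with he | ⟨f, hf⟩
    · simp [he]
    have hB : 2 * B.card ≤ m := by
      simp only [hS, Finset.mem_filter, Finset.mem_univ, true_and] at hf
      obtain ⟨hinv, rfl⟩ := hf
      have hdis : Disjoint (A f) ((A f).image f) := by
        rw [Finset.disjoint_left]
        intro x hx hx'
        obtain ⟨y, hy, rfl⟩ := Finset.mem_image.1 hx'
        simp only [A, Finset.mem_filter, Finset.mem_univ, true_and] at hx hy
        rw [hinv y] at hx
        exact lt_asymm hx hy
      have := Finset.card_le_univ (A f ∪ (A f).image f)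
      rw [Finset.card_union_of_disjoint hdis, Finset.card_image_of_injective _ hinv.injective] at this
      omega
    have hle : (S.filter fun f => A f = B).card ≤ Fintype.card (B → Q) := by
      rw [← Finset.card_univ]
      refine Finset.card_le_card_of_injOn (fun f (b : B) => f b) (fun _ _ => Finset.mem_univ _) ?_
      intro f hf g hg hfg
      simp only [hS, Finset.coe_filter, Finset.mem_filter, Finset.mem_univ, true_and,
        Set.mem_ofPred_eq] at hf hg
      have hagree : ∀ x ∈ B, f x = g x := fun x hx => congrFun hfg ⟨x, hx⟩
      have hfA : ∀ x, x < f x → x ∈ B := fun x hx => by rw [← hf.2]; simpa [A] using hx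
      have hgA : ∀ x, x < g x → x ∈ B := fun x hx => by rw [← hg.2]; simpa [A] using hx
      have key : ∀ {f g : Q → Q}, Function.Involutive f → Function.Involutive g →
          (∀ x, x < f x → f x = g x) → ∀ x, f x ≠ x → f x = g x := by
        intro f g hf hg h x hx
        rcases lt_or_gt_of_ne hx with h1 | h1
        · have := h (f x) (by rwa [hf x])
          rw [hf x] at this
          conv_rhs => rw [this]
          rw [hg]
        · exact h x h1
      funext x
      by_cases h1 : f x = x
      · by_cases h2 : g x = x
        · rw [h1, h2]
        · exact (key hg.1 hf.1 (fun y hy => (hagree y (hgA y hy)).symm) x h2).symm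
      · exact key hf.1 hg.1 (fun y hy => hagree y (hfA y hy)) x h1
    refine hle.trans ?_
    rw [Fintype.card_fun, Fintype.card_coe, ← hm]
    rcases Nat.eq_zero_or_pos m with h0 | h0
    · have : B.card = 0 := by omega
      simp [h0, this]
    · exact Nat.pow_le_pow_right h0 (by omega)
  have hcard : Nat.card {f : Q → Q // Function.Involutive f} ≤ 2 ^ m * m ^ (m / 2) := by
    rw [Nat.card_eq_fintype_card, Fintype.card_subtype,
      Finset.card_eq_sum_card_fiberwise (f := A) (t := Finset.univ) (fun _ _ => by simp)]
    refine (Finset.sum_le_card_nsmul _ _ _ fun B _ => hfib B).trans ?_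
    rw [Finset.card_univ, Fintype.card_finset, smul_eq_mul]
  calc _ ≤ (2 ^ m * m ^ (m / 2)) ^ 2 := Nat.pow_le_pow_left hcard 2
    _ = 4 ^ m * m ^ (m / 2 * 2) := by rw [mul_pow, ← pow_mul, ← pow_mul, mul_comm m 2, pow_mul 2 2 m]; rfl
    _ ≤ _ := by
      refine Nat.mul_le_mul_left _ ?_
      rcases Nat.eq_zero_or_pos m with h0 | h0
      · simp [h0]
      · exact Nat.pow_le_pow_right h0 (by omega)

/-- The number of involutive permutations commuting with a given permutation. -/
noncomputable def commutingCount {D : Type*} (σ : Equiv.Perm D) : ℕ :=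
  Nat.card {α : Equiv.Perm D // α * α = 1 ∧ Commute α σ}

lemma IsSemiregular.stabilizer_eq_bot {D : Type*} [Finite D] {σ : Equiv.Perm D}
    (h : IsSemiregular σ) (x : D) : MulAction.stabilizer (Subgroup.zpowers σ) x = ⊥ := by
  rw [eq_bot_iff]
  rintro ⟨g, hg⟩ hgx
  obtain ⟨i, rfl⟩ := mem_powers_iff_mem_zpowers.2 hg
  exact Subtype.ext (h i x hgx)

lemma IsSemiregular.commutingCount_sq_le {D : Type*} [Fintype D] {σ : Equiv.Perm D}
    (h : IsSemiregular σ) {m : ℕ} (hm : orderOf σ * m = Fintype.card D) :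
    commutingCount σ ^ 2 ≤ 4 ^ m * m ^ m * 4 ^ Fintype.card D := by
  classical
  let H := Subgroup.zpowers σ
  let Q := MulAction.orbitRel.Quotient H D
  have hH : Fintype.card H = orderOf σ := Fintype.card_zpowers
  have hQ : Fintype.card Q = m := by
    have := Fintype.card_congr (MulAction.selfEquivOrbitsQuotientProd h.stabilizer_eq_bot)
    rw [Fintype.card_prod, hH, ← hm, mul_comm] at this
    exact (Nat.eq_of_mul_eq_mul_right (orderOf_pos σ) this).symm
  have hsmul : ∀ α : Equiv.Perm D, Commute α σ → ∀ (g : H) (x : D), α (g • x) = g • α x := by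
    rintro α hα ⟨g, hg⟩ x
    obtain ⟨i, rfl⟩ := Subgroup.mem_zpowers_iff.1 hg
    exact congrArg (fun τ : Equiv.Perm D => τ x) (hα.zpow_right i).eq
  let T := {α : Equiv.Perm D // α * α = 1 ∧ Commute α σ}
  let f : T → Q → Q := fun α => Quotient.map α.1 (by
    rintro x y ⟨g, rfl⟩
    exact ⟨g, (hsmul α.1 α.2.2 g y).symm⟩)
  have hf : ∀ α, Function.Involutive (f α) := by
    intro α q
    induction q using Quotient.inductionOn with
    | h x => exact congrArg _ (congrArg (fun τ : Equiv.Perm D => τ x) α.2.1)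
  have he : ∀ (α : T) (q : Q), ∃ g : H, g • (f α q).out = α.1 q.out := by
    intro α q
    have h1 : f α q = Quotient.mk'' (α.1 q.out) := by
      conv_lhs => rw [← q.out_eq]
      rfl
    rw [h1]
    exact Setoid.symm' (MulAction.orbitRel H D) (Quotient.mk_out' (α.1 q.out))
  choose e he using he
  have hinj : Function.Injective fun α : T =>
      ((⟨f α, hf α⟩, e α) : {f : Q → Q // Function.Involutive f} × (Q → H)) := by
    intro α β hαβ
    simp only [Prod.mk.injEq, Subtype.mk.injEq] at hαβ
    ext x
    obtain ⟨g, hg⟩ : ∃ g : H, g • (Quotient.mk'' x : Q).out = x :=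
      Setoid.symm' (MulAction.orbitRel H D) (Quotient.mk_out' x)
    rw [← hg, hsmul _ α.2.2, hsmul _ β.2.2, ← he, ← he, hαβ.1, hαβ.2]
  have h1 : commutingCount σ ≤
      Nat.card {f : Q → Q // Function.Involutive f} * orderOf σ ^ m := by
    refine (Nat.card_le_card_of_injective _ hinj).trans_eq ?_
    rw [Nat.card_prod, Nat.card_eq_fintype_card (α := Q → H), Fintype.card_fun, hH, hQ]
  have h2 : orderOf σ ^ m ≤ 2 ^ Fintype.card D := by
    rw [← hm, pow_mul]
    exact Nat.pow_le_pow_left Nat.lt_two_pow_self.le m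
  have h3 := card_involutive_sq_le Q
  rw [hQ] at h3
  calc _ ≤ (Nat.card {f : Q → Q // Function.Involutive f} * 2 ^ Fintype.card D) ^ 2 :=
        Nat.pow_le_pow_left (h1.trans (Nat.mul_le_mul_left _ h2)) 2
    _ = Nat.card {f : Q → Q // Function.Involutive f} ^ 2 * 4 ^ Fintype.card D := by
        rw [mul_pow, ← pow_mul, mul_comm _ 2, pow_mul 2 2]; rfl
    _ ≤ _ := Nat.mul_le_mul_right _ h3

/-- The transitive triples on `Fin n`. -/
abbrev TransitiveTriple (n : ℕ) : Type :=
  {t : Equiv.Perm (Fin n) × Equiv.Perm (Fin n) × Equiv.Perm (Fin n) // IsTransitiveTriple t}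

lemma IsFPFInvolution.conj {D : Type*} {σ : Equiv.Perm D} (h : IsFPFInvolution σ)
    (π : Equiv.Perm D) : IsFPFInvolution (π * σ * π⁻¹) := by
  refine ⟨?_, fun x hx => h.2 (π⁻¹ x) ?_⟩
  · rw [show π * σ * π⁻¹ * (π * σ * π⁻¹) = π * (σ * σ) * π⁻¹ by group, h.1]
    group
  · rw [Equiv.Perm.eq_inv_iff_eq]
    exact hx

lemma IsTransitiveTriple.conj {n : ℕ}
    {t : Equiv.Perm (Fin n) × Equiv.Perm (Fin n) × Equiv.Perm (Fin n)}
    (h : IsTransitiveTriple t) (π : Equiv.Perm (Fin n)) :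
    IsTransitiveTriple (π * t.1 * π⁻¹, π * t.2.1 * π⁻¹, π * t.2.2 * π⁻¹) := by
  refine ⟨⟨h.1.1.conj π, h.1.2.1.conj π, h.1.2.2.conj π⟩, fun x y => ?_⟩
  obtain ⟨g, hg, hgx⟩ := h.2 (π⁻¹ x) (π⁻¹ y)
  refine ⟨π * g * π⁻¹, ?_, ?_⟩
  · have := Subgroup.mem_map_of_mem (MulAut.conj π).toMonoidHom hg
    rw [MonoidHom.map_closure] at this
    simpa [Set.image_insert_eq] using this
  · rw [Equiv.Perm.mul_apply, Equiv.Perm.mul_apply, hgx, ← Equiv.Perm.mul_apply, mul_inv_cancel,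
      Equiv.Perm.one_apply]

/-- Simultaneous conjugation of transitive triples. -/
instance (n : ℕ) : MulAction (Equiv.Perm (Fin n)) (TransitiveTriple n) where
  smul π t := ⟨_, t.2.conj π⟩
  one_smul t := Subtype.ext (by simp [HSMul.hSMul])
  mul_smul π ρ t := Subtype.ext (by simp [HSMul.hSMul, mul_assoc])

lemma smul_eq_iff {n : ℕ} (π : Equiv.Perm (Fin n)) (t s : TransitiveTriple n) :
    π • t = s ↔ π * t.1.1 * π⁻¹ = s.1.1 ∧ π * t.1.2.1 * π⁻¹ = s.1.2.1 ∧
      π * t.1.2.2 * π⁻¹ = s.1.2.2 := by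
  rw [Subtype.ext_iff, Prod.ext_iff, Prod.ext_iff]
  rfl

lemma pav_eq_card_orbits (n : ℕ) :
    pav n = Nat.card (MulAction.orbitRel.Quotient (Equiv.Perm (Fin n)) (TransitiveTriple n)) := by
  refine Nat.card_congr (Quot.congrRight fun t s => ?_)
  rw [← Setoid.comm']
  exact exists_congr fun π => (smul_eq_iff π t s).symm

open MulAction in
lemma pav_mul_factorial (n : ℕ) :
    pav n * n.factorial =
      ∑ π : Equiv.Perm (Fin n), Nat.card (fixedBy (TransitiveTriple n) π) := by
  classical
  have := sum_card_fixedBy_eq_card_orbits_mul_card_group (Equiv.Perm (Fin n)) (TransitiveTriple n)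
  rw [Fintype.card_perm, Fintype.card_fin] at this
  rw [pav_eq_card_orbits, Nat.card_eq_fintype_card]
  exact this.symm.trans (Finset.sum_congr rfl fun π _ => Nat.card_eq_fintype_card.symm)

lemma commute_of_smul_eq {n : ℕ} {π : Equiv.Perm (Fin n)} {t : TransitiveTriple n}
    (h : π • t = t) : Commute t.1.1 π ∧ Commute t.1.2.1 π ∧ Commute t.1.2.2 π := by
  obtain ⟨h1, h2, h3⟩ := (smul_eq_iff π t t).1 h
  rw [mul_inv_eq_iff_eq_mul] at h1 h2 h3
  exact ⟨h1.symm, h2.symm, h3.symm⟩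

lemma isSemiregular_of_smul_eq {n : ℕ} {π : Equiv.Perm (Fin n)} {t : TransitiveTriple n}
    (h : π • t = t) : IsSemiregular π := by
  obtain ⟨h1, h2, h3⟩ := commute_of_smul_eq h
  intro i x hx
  ext1 y
  obtain ⟨g, hg, rfl⟩ := t.2.2 x y
  have hcomm : Commute g (π ^ i) := by
    refine Subgroup.closure_induction (p := fun g _ => Commute g (π ^ i)) ?_ (Commute.one_left _)
      (fun _ _ _ _ => Commute.mul_left) (fun _ _ => Commute.inv_left) hg
    rintro g (rfl | rfl | rfl)
    exacts [h1.pow_right i, h2.pow_right i, h3.pow_right i]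
  rw [← Equiv.Perm.mul_apply, ← hcomm.eq, Equiv.Perm.mul_apply, hx, Equiv.Perm.one_apply]

lemma card_fixedBy_le {n : ℕ} (π : Equiv.Perm (Fin n)) :
    Nat.card (MulAction.fixedBy (TransitiveTriple n) π) ≤ commutingCount π ^ 3 := by
  let C := {α : Equiv.Perm (Fin n) // α * α = 1 ∧ Commute α π}
  let F : MulAction.fixedBy (TransitiveTriple n) π → C × C × C := fun t =>
    (⟨t.1.1.1, t.1.2.1.1.1, (commute_of_smul_eq t.2).1⟩,
      ⟨t.1.1.2.1, t.1.2.1.2.1.1, (commute_of_smul_eq t.2).2.1⟩,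
      ⟨t.1.1.2.2, t.1.2.1.2.2.1, (commute_of_smul_eq t.2).2.2⟩)
  have hF : Function.Injective F := by
    intro t s hts
    simp only [F, Prod.mk.injEq, C, Subtype.mk.injEq] at hts
    exact Subtype.ext (Subtype.ext (Prod.ext hts.1 (Prod.ext hts.2.1 hts.2.2)))
  refine (Nat.card_le_card_of_injective F hF).trans_eq ?_
  rw [Nat.card_prod, Nat.card_prod, commutingCount]
  ring

lemma card_transitiveTriple_le (n : ℕ) : Nat.card (TransitiveTriple n) ≤ fpfCount n ^ 3 := by
  let C := {α : Equiv.Perm (Fin n) // IsFPFInvolution α}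
  let F : TransitiveTriple n → C × C × C := fun t =>
    (⟨t.1.1, t.2.1.1⟩, ⟨t.1.2.1, t.2.1.2.1⟩, ⟨t.1.2.2, t.2.1.2.2⟩)
  have hF : Function.Injective F := by
    intro t s hts
    simp only [F, Prod.mk.injEq, C, Subtype.mk.injEq] at hts
    exact Subtype.ext (Prod.ext hts.1 (Prod.ext hts.2.1 hts.2.2))
  refine (Nat.card_le_card_of_injective F hF).trans_eq ?_
  rw [Nat.card_prod, Nat.card_prod, fpfCount]
  ring

lemma card_fixedBy_one (n : ℕ) :
    Nat.card (MulAction.fixedBy (TransitiveTriple n) (1 : Equiv.Perm (Fin n))) =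
      Nat.card (TransitiveTriple n) :=
  Nat.card_congr ((Equiv.setCongr (MulAction.fixedBy_one_eq_univ _ _)).trans (Equiv.Set.univ _))

lemma card_transitiveTriple_le_pav (n : ℕ) :
    Nat.card (TransitiveTriple n) ≤ pav n * n.factorial := by
  rw [pav_mul_factorial, ← card_fixedBy_one]
  exact Finset.single_le_sum (f := fun π : Equiv.Perm (Fin n) =>
    Nat.card (MulAction.fixedBy (TransitiveTriple n) π)) (fun _ _ => Nat.zero_le _)
    (Finset.mem_univ 1)

open Classical in
lemma pav_mul_factorial_le (n : ℕ) :
    pav n * n.factorial ≤ fpfCount n ^ 3 +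
      ∑ π : Equiv.Perm (Fin n) with IsSemiregular π ∧ π ≠ 1, commutingCount π ^ 3 := by
  rw [pav_mul_factorial, ← Finset.add_sum_erase _ _ (Finset.mem_univ 1), card_fixedBy_one]
  refine Nat.add_le_add (card_transitiveTriple_le n) ?_
  rw [Finset.sum_filter, ← Finset.sum_erase Finset.univ (a := (1 : Equiv.Perm (Fin n)))
    (f := fun π => if IsSemiregular π ∧ π ≠ 1 then commutingCount π ^ 3 else 0) (by simp)]
  refine Finset.sum_le_sum fun π hπ => ?_
  split_ifs with h
  · exact card_fixedBy_le π
  · rw [Nat.le_zero, Nat.card_eq_zero]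
    left
    refine ⟨fun t => h ⟨isSemiregular_of_smul_eq t.2, Finset.ne_of_mem_erase hπ⟩⟩

open Classical in
lemma card_preserving_le {n : ℕ} (S : Finset (Fin n)) :
    (Finset.univ.filter fun σ : Equiv.Perm (Fin n) =>
      IsFPFInvolution σ ∧ ∀ x, σ x ∈ S ↔ x ∈ S).card ≤ fpfCount S.card * fpfCount (n - S.card) := by
  have hres : ∀ {p : Fin n → Prop} {σ : Equiv.Perm (Fin n)} (hp : ∀ x, p (σ x) ↔ p x),
      IsFPFInvolution σ → IsFPFInvolution (σ.subtypePerm hp) := by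
    intro p σ hp h
    refine ⟨Equiv.ext fun x => Subtype.ext ?_, fun x hx => h.2 x (congrArg Subtype.val hx)⟩
    exact congrArg (fun τ : Equiv.Perm (Fin n) => τ x) h.1
  have h1 := card_isFPFInvolution {x // x ∈ S}
  have h2 := card_isFPFInvolution {x // x ∉ S}
  rw [Fintype.card_coe] at h1
  rw [Fintype.card_subtype_compl, Fintype.card_coe, Fintype.card_fin] at h2
  rw [← h1, ← h2, ← Nat.card_prod, ← Fintype.card_subtype, ← Nat.card_eq_fintype_card]
  refine Nat.card_le_card_of_injective (fun σ => (⟨σ.1.subtypePerm σ.2.2, hres _ σ.2.1⟩,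
    ⟨σ.1.subtypePerm fun x => not_congr (σ.2.2 x), hres _ σ.2.1⟩)) ?_
  intro σ τ h
  simp only [Prod.mk.injEq, Subtype.mk.injEq] at h
  ext x : 2
  by_cases hx : x ∈ S
  · exact congrArg Subtype.val (congrArg (fun ρ : Equiv.Perm {x // x ∈ S} => ρ ⟨x, hx⟩) h.1)
  · exact congrArg Subtype.val (congrArg (fun ρ : Equiv.Perm {x // x ∉ S} => ρ ⟨x, hx⟩) h.2)

lemma exists_preserved_of_not_transitive {n : ℕ}
    {t : Equiv.Perm (Fin n) × Equiv.Perm (Fin n) × Equiv.Perm (Fin n)}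
    (h : ¬ ∀ x y : Fin n, ∃ g ∈ Subgroup.closure ({t.1, t.2.1, t.2.2} :
      Set (Equiv.Perm (Fin n))), g x = y) :
    ∃ S : Finset (Fin n), (S.card ≠ 0 ∧ S.card ≠ n) ∧ (∀ x, t.1 x ∈ S ↔ x ∈ S) ∧
      (∀ x, t.2.1 x ∈ S ↔ x ∈ S) ∧ ∀ x, t.2.2 x ∈ S ↔ x ∈ S := by
  classical
  push Not at h
  obtain ⟨x, y, hxy⟩ := h
  let G := Subgroup.closure ({t.1, t.2.1, t.2.2} : Set (Equiv.Perm (Fin n)))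
  let S : Finset (Fin n) := Finset.univ.filter fun z => ∃ g ∈ G, g x = z
  have hS : ∀ σ ∈ G, ∀ z, σ z ∈ S ↔ z ∈ S := by
    intro σ hσ z
    simp only [S, Finset.mem_filter, Finset.mem_univ, true_and]
    constructor
    · rintro ⟨g, hg, hz⟩
      exact ⟨σ⁻¹ * g, G.mul_mem (G.inv_mem hσ) hg, by simp [hz]⟩
    · rintro ⟨g, hg, rfl⟩
      exact ⟨σ * g, G.mul_mem hσ hg, rfl⟩
  have hx : x ∈ S := Finset.mem_filter.2 ⟨Finset.mem_univ _, 1, G.one_mem, rfl⟩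
  have hy : y ∉ S := fun hy => by
    obtain ⟨g, hg, hgx⟩ := (Finset.mem_filter.1 hy).2
    exact hxy g hg hgx
  refine ⟨S, ⟨Finset.card_ne_zero_of_mem hx, fun hn => hy ?_⟩,
    hS _ (Subgroup.subset_closure (by simp)), hS _ (Subgroup.subset_closure (by simp)),
    hS _ (Subgroup.subset_closure (by simp))⟩
  rw [Finset.card_eq_iff_eq_univ S |>.1 (by rw [hn, Fintype.card_fin])]
  exact Finset.mem_univ _

lemma fpfCount_pow_three_le (n : ℕ) :
    fpfCount n ^ 3 ≤ Nat.card (TransitiveTriple n) +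
      ∑ s ∈ Finset.Ioo 0 n, n.choose s * (fpfCount s * fpfCount (n - s)) ^ 3 := by
  classical
  let P := Equiv.Perm (Fin n)
  let U : Finset P := Finset.univ.filter IsFPFInvolution
  let N : Finset (Fin n) → Finset P := fun S =>
    Finset.univ.filter fun σ => IsFPFInvolution σ ∧ ∀ x, σ x ∈ S ↔ x ∈ S
  let R : Finset (Finset (Fin n)) := Finset.univ.filter fun S => S.card ≠ 0 ∧ S.card ≠ n
  let T : Finset (P × P × P) := Finset.univ.filter IsTransitiveTriple
  have hsub : U ×ˢ U ×ˢ U ⊆ T ∪ R.biUnion fun S => N S ×ˢ N S ×ˢ N S := by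
    intro t ht
    simp only [U, Finset.mem_product, Finset.mem_filter, Finset.mem_univ, true_and] at ht
    simp only [T, R, N, Finset.mem_union, Finset.mem_biUnion, Finset.mem_product,
      Finset.mem_filter, Finset.mem_univ, true_and]
    by_cases htr : IsTransitiveTriple t
    · exact Or.inl htr
    · obtain ⟨S, hS, h1, h2, h3⟩ := exists_preserved_of_not_transitive fun h => htr ⟨ht, h⟩
      exact Or.inr ⟨S, hS, ⟨ht.1, h1⟩, ⟨ht.2.1, h2⟩, ht.2.2, h3⟩
  have hU : (U ×ˢ U ×ˢ U).card = fpfCount n ^ 3 := by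
    rw [Finset.card_product, Finset.card_product, fpfCount, Nat.card_eq_fintype_card,
      Fintype.card_subtype]
    ring
  have hT : T.card = Nat.card (TransitiveTriple n) := by
    rw [Nat.card_eq_fintype_card, Fintype.card_subtype]
  let g : ℕ → ℕ := fun s => if s ≠ 0 ∧ s ≠ n then (fpfCount s * fpfCount (n - s)) ^ 3 else 0
  have hN : ∀ S ∈ R, (N S ×ˢ N S ×ˢ N S).card ≤ (fpfCount S.card * fpfCount (n - S.card)) ^ 3 := by
    intro S _
    rw [Finset.card_product, Finset.card_product, ← mul_assoc, ← pow_three']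
    exact Nat.pow_le_pow_left (card_preserving_le S) 3
  rw [← hU, ← hT]
  refine (Finset.card_le_card hsub).trans ((Finset.card_union_le _ _).trans ?_)
  refine Nat.add_le_add_left (Finset.card_biUnion_le.trans ((Finset.sum_le_sum hN).trans ?_)) _
  have h := Finset.sum_powerset_apply_card g (x := (Finset.univ : Finset (Fin n)))
  rw [Finset.powerset_univ, Finset.card_univ, Fintype.card_fin] at h
  rw [Finset.sum_filter]
  refine h.trans_le ?_
  simp only [smul_eq_mul, g, mul_ite, mul_zero]
  rw [← Finset.sum_filter]
  refine Finset.sum_le_sum_of_subset fun s hs => ?_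
  simp only [Finset.mem_filter, Finset.mem_range, Finset.mem_Ioo] at hs ⊢
  omega

lemma pow_self_le_three_pow_mul_factorial (m : ℕ) :
    (m : ℝ) ^ m ≤ 3 ^ m * (m.factorial : ℝ) := by
  have h := Real.pow_div_factorial_le_exp (m : ℝ) m.cast_nonneg m
  rw [div_le_iff₀ (by positivity)] at h
  refine h.trans (mul_le_mul_of_nonneg_right ?_ (by positivity))
  rw [← Real.exp_one_pow]
  exact pow_le_pow_left₀ (Real.exp_pos 1).le (Real.exp_one_lt_d9.le.trans (by norm_num)) m

open Classical in
lemma sum_commutingCount_orderOf_le {k : ℕ} (hk : 0 < k) (d : ℕ) :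
    (∑ π : Equiv.Perm (Fin (2 * k)) with (IsSemiregular π ∧ π ≠ 1) ∧ orderOf π = d,
      (commutingCount π : ℝ) ^ 3) ≤
      (2 * k).factorial * √((64 ^ 3 * 9) ^ k * (k : ℝ) ^ k) := by
  set P := Finset.univ.filter fun π : Equiv.Perm (Fin (2 * k)) =>
    (IsSemiregular π ∧ π ≠ 1) ∧ orderOf π = d with hP
  rcases P.eq_empty_or_nonempty with he | ⟨π₀, hπ₀⟩
  · rw [he, Finset.sum_empty]
    positivity
  simp only [hP, Finset.mem_filter, Finset.mem_univ, true_and] at hπ₀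
  obtain ⟨⟨hs, h1⟩, rfl⟩ := hπ₀
  set d := orderOf π₀
  obtain ⟨hdm, -⟩ := hs.cycleType_eq h1
  rw [Fintype.card_fin] at hdm
  set m := 2 * k / d with hm
  have hd : 2 ≤ d := by
    have h0 : d ≠ 0 := (orderOf_pos π₀).ne'
    have h1' : d ≠ 1 := fun h => h1 (orderOf_eq_one_iff.1 h)
    omega
  have hmk : m ≤ k := by nlinarith
  have hcard : P.card * m.factorial ≤ (2 * k).factorial := by
    have h := card_cycleType_replicate (D := Fin (2 * k)) hd (by rw [Fintype.card_fin, hdm])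
    rw [Fintype.card_fin] at h
    rw [← h]
    refine Nat.mul_le_mul (Finset.card_le_card fun π hπ => ?_)
      (Nat.le_mul_of_pos_left _ (by positivity))
    simp only [hP, Finset.mem_filter, Finset.mem_univ, true_and] at hπ ⊢
    have := (hπ.1.1.cycleType_eq hπ.1.2).2
    rwa [hπ.2, Fintype.card_fin] at this
  have hcomm : ∀ π ∈ P, (commutingCount π : ℝ) ^ 3 ≤ √((64 : ℝ) ^ k * (m : ℝ) ^ m) ^ 3 := by
    intro π hπ
    simp only [hP, Finset.mem_filter, Finset.mem_univ, true_and] at hπ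
    have h := hπ.1.1.commutingCount_sq_le (m := m) (by rw [hπ.2, hdm, Fintype.card_fin])
    rw [Fintype.card_fin, pow_mul 4 2 k] at h
    refine pow_le_pow_left₀ (Nat.cast_nonneg _) (Real.le_sqrt_of_sq_le ?_) 3
    have h' : commutingCount π ^ 2 ≤ 64 ^ k * m ^ m :=
      calc _ ≤ 4 ^ m * m ^ m * (4 ^ 2) ^ k := h
        _ ≤ 4 ^ k * m ^ m * (4 ^ 2) ^ k := by gcongr; norm_num
        _ = (4 * 4 ^ 2) ^ k * m ^ m := by rw [mul_pow]; ring
        _ = _ := by norm_num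
    exact_mod_cast h'
  have hcardR : (P.card : ℝ) * m.factorial ≤ (2 * k).factorial := by exact_mod_cast hcard
  have hmm : (m : ℝ) ^ m ≤ (k : ℝ) ^ k := by
    exact_mod_cast (Nat.pow_le_pow_left hmk m).trans (Nat.pow_le_pow_right hk hmk)
  have hroot : √((64 : ℝ) ^ k * (m : ℝ) ^ m) ^ 3 ≤
      m.factorial * √((64 ^ 3 * 9) ^ k * (k : ℝ) ^ k) := by
    refine abs_le_of_sq_le_sq' ?_ (by positivity) |>.2
    rw [← pow_mul, mul_comm 3 2, pow_mul, mul_pow (m.factorial : ℝ), Real.sq_sqrt (by positivity),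
      Real.sq_sqrt (by positivity)]
    calc ((64 : ℝ) ^ k * (m : ℝ) ^ m) ^ 3
        = (64 ^ 3) ^ k * ((m : ℝ) ^ m) ^ 2 * (m : ℝ) ^ m := by
          rw [pow_right_comm (64 : ℝ)]
          ring
      _ ≤ (64 ^ 3) ^ k * (3 ^ k * (m.factorial : ℝ)) ^ 2 * (k : ℝ) ^ k := by
          gcongr
          refine (pow_self_le_three_pow_mul_factorial m).trans ?_
          gcongr
          norm_num
      _ = (m.factorial : ℝ) ^ 2 * ((64 ^ 3) ^ k * (3 ^ 2) ^ k * (k : ℝ) ^ k) := by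
          rw [pow_right_comm (3 : ℝ)]
          ring
      _ = _ := by rw [← mul_pow]; norm_num
  calc _ ≤ P.card • √((64 : ℝ) ^ k * (m : ℝ) ^ m) ^ 3 := Finset.sum_le_card_nsmul _ _ _ hcomm
    _ ≤ P.card * (m.factorial * √((64 ^ 3 * 9) ^ k * (k : ℝ) ^ k)) := by
        rw [nsmul_eq_mul]
        gcongr
    _ = (P.card * m.factorial) * √((64 ^ 3 * 9) ^ k * (k : ℝ) ^ k) := by ring
    _ ≤ _ := by gcongr

open Classical in
lemma sum_commutingCount_le {k : ℕ} (hk : 0 < k) :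
    (∑ π : Equiv.Perm (Fin (2 * k)) with IsSemiregular π ∧ π ≠ 1, (commutingCount π : ℝ) ^ 3) ≤
      2 * k * ((2 * k).factorial * √((64 ^ 3 * 9) ^ k * (k : ℝ) ^ k)) := by
  have hmaps : ∀ π ∈ Finset.univ.filter fun π : Equiv.Perm (Fin (2 * k)) =>
      IsSemiregular π ∧ π ≠ 1, orderOf π ∈ Finset.Icc 1 (2 * k) := by
    intro π hπ
    simp only [Finset.mem_filter, Finset.mem_univ, true_and] at hπ
    have h := (hπ.1.cycleType_eq hπ.2).1
    rw [Fintype.card_fin] at h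
    exact Finset.mem_Icc.2 ⟨orderOf_pos π, Nat.le_of_dvd (by omega) ⟨_, h.symm⟩⟩
  rw [← Finset.sum_fiberwise_of_maps_to hmaps]
  refine (Finset.sum_le_card_nsmul _ _ ((2 * k).factorial * √((64 ^ 3 * 9) ^ k * (k : ℝ) ^ k))
    fun d _ => ?_).trans_eq ?_
  · rw [Finset.filter_filter]
    exact sum_commutingCount_orderOf_le hk d
  · rw [Nat.card_Icc, nsmul_eq_mul]
    push_cast [Nat.add_sub_cancel]
    ring

lemma choose_mul_fpfCount {k j : ℕ} (hj : j ≤ k) :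
    (2 * k).choose (2 * j) * (fpfCount (2 * j) * fpfCount (2 * (k - j))) =
      k.choose j * fpfCount (2 * k) := by
  have h1 := fpfCount_two_mul j
  have h2 := fpfCount_two_mul (k - j)
  have h3 := fpfCount_two_mul k
  have h4 := Nat.choose_mul_factorial_mul_factorial hj
  have h5 := Nat.choose_mul_factorial_mul_factorial (Nat.mul_le_mul_left 2 hj)
  rw [← Nat.mul_sub, ← h1, ← h2, ← h3, ← h4] at h5
  have hpow : 2 ^ k = 2 ^ j * 2 ^ (k - j) := by rw [← pow_add, Nat.add_sub_cancel' hj]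
  rw [hpow] at h5
  have hpos : 0 < 2 ^ j * 2 ^ (k - j) * (j.factorial * (k - j).factorial) := by positivity
  refine Nat.eq_of_mul_eq_mul_right hpos ?_
  linarith

lemma choose_sq_le (k j : ℕ) : k.choose j ^ 2 ≤ (2 * k).choose (2 * j) := by
  rw [two_mul k, Nat.add_choose_eq, pow_two]
  exact Finset.single_le_sum (f := fun ij : ℕ × ℕ => k.choose ij.1 * k.choose ij.2)
    (fun _ _ => Nat.zero_le _) (Finset.HasAntidiagonal.mem_antidiagonal.2 (two_mul j).symm : (j, j) ∈ _)

lemma choose_mul_fpfCount_pow_le {k j : ℕ} (hj : j ≤ k) :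
    (2 * k).choose (2 * j) * (fpfCount (2 * j) * fpfCount (2 * (k - j))) ^ 3 * k.choose j ≤
      fpfCount (2 * k) ^ 3 := by
  have h1 := choose_mul_fpfCount hj
  have h2 := choose_sq_le k j
  have hc : 0 < k.choose j := Nat.choose_pos hj
  set x := fpfCount (2 * j) * fpfCount (2 * (k - j))
  set c := k.choose j
  set b := (2 * k).choose (2 * j)
  set y := fpfCount (2 * k)
  have h3 : c * x ≤ y := by
    refine Nat.le_of_mul_le_mul_left ?_ hc
    rw [← h1, ← mul_assoc, ← pow_two]
    exact Nat.mul_le_mul_right x h2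
  calc b * x ^ 3 * c = b * x * x ^ 2 * c := by ring
    _ = y * (c * x) ^ 2 := by rw [h1]; ring
    _ ≤ y * y ^ 2 := by gcongr
    _ = y ^ 3 := by ring

lemma choose_two_le_choose (a b : ℕ) : (a + b + 4).choose 2 ≤ (a + b + 4).choose (a + 2) := by
  induction a generalizing b with
  | zero => simp
  | succ a iha =>
    induction b with
    | zero => rw [← Nat.choose_symm_of_eq_add (show a + 1 + 0 + 4 = 2 + (a + 1 + 2) by ring)]
    | succ b ihb =>
      have h1 := iha (b + 1)
      rw [show a + (b + 1) + 4 = a + b + 5 by ring] at h1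
      rw [show a + 1 + b + 4 = a + b + 5 by ring] at ihb
      rw [show a + 1 + (b + 1) + 4 = (a + b + 5) + 1 by ring, Nat.choose_succ_succ' _ (a + 1 + 1),
        Nat.choose_succ_succ' _ 1, Nat.choose_one_right]
      have h2 : a + b + 5 ≤ (a + b + 5).choose 2 := by
        rw [Nat.choose_succ_succ' (a + b + 4) 1, Nat.choose_one_right,
          Nat.choose_succ_succ' (a + b + 3) 1, Nat.choose_one_right]
        omega
      exact Nat.add_le_add (h2.trans h1) ihb

lemma sum_inv_choose_le {k : ℕ} (hk : 2 ≤ k) :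
    ∑ j ∈ Finset.Ioo 0 k, (1 / (k.choose j : ℝ)) ≤ 4 / k := by
  have hk' : (2 : ℝ) ≤ k := by exact_mod_cast hk
  have hle : ∀ j ∈ Finset.Ioo 0 k, (1 / (k.choose j : ℝ)) ≤
      2 / (k * (k - 1)) + ((if j = 1 then 1 / (k : ℝ) else 0) +
        if j = k - 1 then 1 / (k : ℝ) else 0) := by
    intro j hj
    rw [Finset.mem_Ioo] at hj
    have hpos : (0 : ℝ) ≤ 2 / (k * (k - 1)) := div_nonneg two_pos.le (by nlinarith)
    have hpos' : (0 : ℝ) ≤ 1 / k := by positivity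
    by_cases h1 : j = 1
    · rw [if_pos h1, h1, Nat.choose_one_right]
      split_ifs <;> linarith
    by_cases h2 : j = k - 1
    · rw [if_pos h2, h2, Nat.choose_symm (by omega), Nat.choose_one_right]
      split_ifs <;> linarith
    rw [if_neg h1, if_neg h2, add_zero, add_zero]
    have h := choose_two_le_choose (j - 2) (k - j - 2)
    rw [show j - 2 + (k - j - 2) + 4 = k by omega, show j - 2 + 2 = j by omega] at h
    have h' : (k.choose 2 : ℝ) ≤ k.choose j := by exact_mod_cast h
    rw [Nat.cast_choose_two] at h'
    calc (1 / (k.choose j : ℝ)) ≤ 1 / (k * (k - 1) / 2) :=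
          one_div_le_one_div_of_le (by nlinarith) h'
      _ = _ := one_div_div _ _
  refine (Finset.sum_le_sum hle).trans ?_
  rw [Finset.sum_add_distrib, Finset.sum_add_distrib, Finset.sum_const, Nat.card_Ioo,
    Finset.sum_ite_eq', Finset.sum_ite_eq', if_pos (Finset.mem_Ioo.2 (by omega)),
    if_pos (Finset.mem_Ioo.2 (by omega)), nsmul_eq_mul, Nat.sub_zero, Nat.cast_sub (by omega),
    Nat.cast_one]
  have : (k : ℝ) - 1 ≠ 0 := by linarith
  have : (k : ℝ) ≠ 0 := by linarith
  apply le_of_eq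
  field_simp
  ring

lemma sum_nontransitive_le {k : ℕ} (hk : 2 ≤ k) :
    (∑ s ∈ Finset.Ioo 0 (2 * k),
      ((2 * k).choose s : ℝ) * (fpfCount s * fpfCount (2 * k - s)) ^ 3) ≤
      (fpfCount (2 * k) : ℝ) ^ 3 * (4 / k) := by
  have hsub : (Finset.Ioo 0 k).image (2 * ·) ⊆ Finset.Ioo 0 (2 * k) := by
    intro s hs
    simp only [Finset.mem_image, Finset.mem_Ioo] at hs ⊢
    omega
  rw [← Finset.sum_subset hsub, Finset.sum_image (by simp)]
  · refine le_trans (Finset.sum_le_sum fun j hj => ?_)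
      ((Finset.mul_sum _ _ _).symm.trans_le
        (mul_le_mul_of_nonneg_left (sum_inv_choose_le hk) (by positivity)))
    rw [Finset.mem_Ioo] at hj
    have hc : (0 : ℝ) < k.choose j := by exact_mod_cast Nat.choose_pos hj.2.le
    rw [mul_one_div, le_div_iff₀ hc, ← Nat.mul_sub]
    exact_mod_cast choose_mul_fpfCount_pow_le hj.2.le
  · intro s hs hs'
    have hodd : Odd s := by
      rw [← Nat.not_even_iff_odd]
      rintro ⟨j, rfl⟩
      refine hs' (Finset.mem_image.2 ⟨j, ?_, two_mul j⟩)
      rw [Finset.mem_Ioo] at hs ⊢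
      omega
    simp [fpfCount_of_odd hodd]

lemma factorial_mul_factorial_le_fpfCount (k : ℕ) :
    k.factorial * (2 * k).factorial ≤ fpfCount (2 * k) ^ 3 * 8 ^ k := by
  have h := fpfCount_two_mul k
  have h1 : k.factorial * k.factorial ≤ (2 * k).factorial := by
    rw [two_mul]
    exact Nat.le_of_dvd (Nat.factorial_pos _) (Nat.factorial_mul_factorial_dvd_factorial_add k k)
  refine Nat.le_of_mul_le_mul_right ?_ (pow_pos k.factorial_pos 3)
  calc k.factorial * (2 * k).factorial * k.factorial ^ 3
      = (k.factorial * k.factorial) ^ 2 * (2 * k).factorial := by ring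
    _ ≤ (2 * k).factorial ^ 2 * (2 * k).factorial := by gcongr
    _ = (fpfCount (2 * k) * (2 ^ k * k.factorial)) ^ 3 := by rw [h]; ring
    _ = fpfCount (2 * k) ^ 3 * (2 ^ k) ^ 3 * k.factorial ^ 3 := by ring
    _ = fpfCount (2 * k) ^ 3 * 8 ^ k * k.factorial ^ 3 := by rw [pow_right_comm]; norm_num

lemma fpfCount_two_mul_pos (k : ℕ) : 0 < fpfCount (2 * k) :=
  Nat.pos_of_ne_zero fun h => by
    have := fpfCount_two_mul k
    rw [h, zero_mul] at this
    exact (2 * k).factorial_ne_zero this.symm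

lemma sum_commutingCount_le_fpfCount {k : ℕ} :
    2 * k * ((2 * k).factorial * √((64 ^ 3 * 9) ^ k * (k : ℝ) ^ k)) ≤
      (fpfCount (2 * k) : ℝ) ^ 3 *
        √(4 * ((4 * 64 * (64 ^ 3 * 9) * 3) ^ k / (k.factorial : ℝ))) := by
  have hfac : (0 : ℝ) < k.factorial := by positivity
  have h1 : ((2 * k).factorial : ℝ) ≤ (fpfCount (2 * k) : ℝ) ^ 3 * (8 ^ k / k.factorial) := by
    rw [← mul_div_assoc, le_div_iff₀ hfac, mul_comm]
    exact_mod_cast factorial_mul_factorial_le_fpfCount k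
  have h2 : (k : ℝ) ≤ 2 ^ k := by exact_mod_cast Nat.lt_two_pow_self.le
  have h3 : 2 * k * (8 ^ k / k.factorial) * √((64 ^ 3 * 9) ^ k * (k : ℝ) ^ k) ≤
      √(4 * ((4 * 64 * (64 ^ 3 * 9) * 3) ^ k / (k.factorial : ℝ))) := by
    refine Real.le_sqrt_of_sq_le ?_
    rw [mul_pow, Real.sq_sqrt (by positivity)]
    calc (2 * k * (8 ^ k / (k.factorial : ℝ))) ^ 2 * ((64 ^ 3 * 9) ^ k * (k : ℝ) ^ k)
        ≤ (2 * 2 ^ k * (8 ^ k / (k.factorial : ℝ))) ^ 2 *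
            ((64 ^ 3 * 9) ^ k * (3 ^ k * k.factorial)) := by
          gcongr
          exact pow_self_le_three_pow_mul_factorial k
      _ = 4 * (((2 ^ k) ^ 2 * (8 ^ k) ^ 2 * (64 ^ 3 * 9) ^ k * 3 ^ k) / (k.factorial : ℝ)) := by
          field_simp
          ring
      _ = _ := by
          rw [pow_right_comm, pow_right_comm (8 : ℝ), ← mul_pow, ← mul_pow, ← mul_pow]
          norm_num
  calc 2 * k * ((2 * k).factorial * √((64 ^ 3 * 9) ^ k * (k : ℝ) ^ k))
      ≤ 2 * k * ((fpfCount (2 * k) : ℝ) ^ 3 * (8 ^ k / k.factorial) *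
          √((64 ^ 3 * 9) ^ k * (k : ℝ) ^ k)) := by gcongr
    _ = (fpfCount (2 * k) : ℝ) ^ 3 *
          (2 * k * (8 ^ k / k.factorial) * √((64 ^ 3 * 9) ^ k * (k : ℝ) ^ k)) := by ring
    _ ≤ _ := by gcongr

/-- The number of all triples of fixed-point-free involutions on `Fin (2 * k)`, divided by the
order of the symmetric group. -/
noncomputable def tripleQuotient (k : ℕ) : ℝ :=
  (fpfCount (2 * k) : ℝ) ^ 3 / (2 * k).factorial

lemma tripleQuotient_pos (k : ℕ) : 0 < tripleQuotient k := by
  have : (0 : ℝ) < fpfCount (2 * k) := by exact_mod_cast fpfCount_two_mul_pos k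
  unfold tripleQuotient
  positivity

lemma pav_le_tripleQuotient {k : ℕ} (hk : 0 < k) :
    (pav (2 * k) : ℝ) ≤ tripleQuotient k *
      (1 + √(4 * ((4 * 64 * (64 ^ 3 * 9) * 3) ^ k / (k.factorial : ℝ)))) := by
  classical
  have hfac : (0 : ℝ) < (2 * k).factorial := by positivity
  have h : (pav (2 * k) : ℝ) * (2 * k).factorial ≤ (fpfCount (2 * k) : ℝ) ^ 3 +
      ∑ π : Equiv.Perm (Fin (2 * k)) with IsSemiregular π ∧ π ≠ 1, (commutingCount π : ℝ) ^ 3 := by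
    exact_mod_cast pav_mul_factorial_le (2 * k)
  rw [tripleQuotient, div_mul_eq_mul_div, le_div_iff₀ hfac, mul_add, mul_one]
  exact h.trans (by gcongr; exact (sum_commutingCount_le hk).trans sum_commutingCount_le_fpfCount)

lemma tripleQuotient_le_pav {k : ℕ} (hk : 2 ≤ k) :
    tripleQuotient k * (1 - 4 / k) ≤ pav (2 * k) := by
  have hfac : (0 : ℝ) < (2 * k).factorial := by positivity
  have h1 : (fpfCount (2 * k) : ℝ) ^ 3 ≤ Nat.card (TransitiveTriple (2 * k)) +
      ∑ s ∈ Finset.Ioo 0 (2 * k),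
        ((2 * k).choose s : ℝ) * (fpfCount s * fpfCount (2 * k - s)) ^ 3 := by
    exact_mod_cast fpfCount_pow_three_le (2 * k)
  have h2 : (Nat.card (TransitiveTriple (2 * k)) : ℝ) ≤ pav (2 * k) * (2 * k).factorial := by
    exact_mod_cast card_transitiveTriple_le_pav (2 * k)
  rw [tripleQuotient, div_mul_eq_mul_div, div_le_iff₀ hfac, mul_sub, mul_one]
  linarith [sum_nontransitive_le hk]

lemma tendsto_pav_div_tripleQuotient :
    Tendsto (fun k : ℕ => (pav (2 * k) : ℝ) / tripleQuotient k) atTop (nhds 1) := by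
  have hlow : Tendsto (fun k : ℕ => 1 - 4 / (k : ℝ)) atTop (nhds 1) := by
    simpa using (tendsto_const_div_atTop_nhds_zero_nat (4 : ℝ)).const_sub 1
  have hup : Tendsto (fun k : ℕ =>
      1 + √(4 * ((4 * 64 * (64 ^ 3 * 9) * 3) ^ k / (k.factorial : ℝ)))) atTop (nhds 1) := by
    have h := ((FloorSemiring.tendsto_pow_div_factorial_atTop
      (4 * 64 * (64 ^ 3 * 9) * 3 : ℝ)).const_mul 4).sqrt.const_add 1
    rwa [mul_zero, Real.sqrt_zero, add_zero] at h
  refine tendsto_of_tendsto_of_tendsto_of_le_of_le' hlow hup ?_ ?_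
  · filter_upwards [eventually_ge_atTop 2] with k hk
    rw [le_div_iff₀' (tripleQuotient_pos k)]
    exact tripleQuotient_le_pav hk
  · filter_upwards [eventually_ge_atTop 1] with k hk
    rw [div_le_iff₀' (tripleQuotient_pos k)]
    exact pav_le_tripleQuotient hk

lemma factorial_eq_stirlingSeq_mul {n : ℕ} (hn : 0 < n) :
    (n.factorial : ℝ) = Stirling.stirlingSeq n * (√(2 * n) * (n / Real.exp 1) ^ n) := by
  have : (0 : ℝ) < n := by exact_mod_cast hn
  rw [Stirling.stirlingSeq, div_mul_cancel₀]
  positivity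

lemma tripleQuotient_div_eq {k : ℕ} (hk : 0 < k) :
    tripleQuotient k / (√(2 / Real.pi) * (2 / Real.exp 1) ^ k * (k : ℝ) ^ ((k : ℝ) - 1 / 2)) =
      Stirling.stirlingSeq (2 * k) ^ 2 / Stirling.stirlingSeq k ^ 3 * √Real.pi := by
  have hk0 : (0 : ℝ) < k := by exact_mod_cast hk
  have h1 := factorial_eq_stirlingSeq_mul hk
  have h2 := factorial_eq_stirlingSeq_mul (n := 2 * k) (by omega)
  have hF : (fpfCount (2 * k) : ℝ) * (2 ^ k * k.factorial) = (2 * k).factorial := by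
    exact_mod_cast fpfCount_two_mul k
  have hfac : (0 : ℝ) < k.factorial := by positivity
  have hfac2 : (0 : ℝ) < (2 * k).factorial := by positivity
  set S := Stirling.stirlingSeq k
  set T := Stirling.stirlingSeq (2 * k)
  have hS : S ≠ 0 := fun h => by rw [h, zero_mul] at h1; exact hfac.ne' h1
  have hsplit : ((2 * k : ℕ) : ℝ) / Real.exp 1 = 2 * (k / Real.exp 1) := by
    push_cast
    ring
  have hroot : √(2 * ((2 * k : ℕ) : ℝ)) = 2 * √k := by
    rw [show (2 * ((2 * k : ℕ) : ℝ)) = 2 ^ 2 * k by push_cast; ring,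
      Real.sqrt_mul (by positivity), Real.sqrt_sq two_pos.le]
  rw [hsplit, hroot, mul_pow, pow_mul', pow_mul'] at h2
  rw [Real.sqrt_mul two_pos.le] at h1
  have hpow : (2 / Real.exp 1) ^ k * (k : ℝ) ^ ((k : ℝ) - 1 / 2) =
      2 ^ k * (k / Real.exp 1) ^ k / √k := by
    rw [Real.rpow_sub hk0, Real.rpow_natCast, ← Real.sqrt_eq_rpow, div_pow, div_pow]
    ring
  have hquot : tripleQuotient k =
      (2 * k).factorial ^ 2 / ((2 ^ k) ^ 3 * (k.factorial : ℝ) ^ 3) := by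
    rw [tripleQuotient, div_eq_div_iff hfac2.ne' (by positivity), ← pow_succ, ← hF]
    ring
  rw [hquot, mul_assoc, hpow, Real.sqrt_div two_pos.le, h1, h2]
  have hr : (0 : ℝ) < (k / Real.exp 1) ^ k := by positivity
  have hq : (0 : ℝ) < (2 : ℝ) ^ k := by positivity
  have hu : (0 : ℝ) < √k := Real.sqrt_pos.2 hk0
  have hw : (0 : ℝ) < √2 := by positivity
  have hp : (0 : ℝ) < √Real.pi := Real.sqrt_pos.2 Real.pi_pos
  have hw2 : √2 ^ 4 = (4 : ℝ) := by
    rw [show 4 = 2 * 2 by rfl, pow_mul, Real.sq_sqrt two_pos.le]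
    norm_num
  generalize ((k : ℝ) / Real.exp 1) ^ k = r at *
  generalize (2 : ℝ) ^ k = q at *
  generalize √(k : ℝ) = u at *
  generalize √(2 : ℝ) = w at *
  generalize √Real.pi = p at *
  field_simp
  rw [hw2]
  ring

lemma tendsto_tripleQuotient_div :
    Tendsto (fun k : ℕ => tripleQuotient k /
      (√(2 / Real.pi) * (2 / Real.exp 1) ^ k * (k : ℝ) ^ ((k : ℝ) - 1 / 2))) atTop (nhds 1) := by
  have hp : (0 : ℝ) < √Real.pi := Real.sqrt_pos.2 Real.pi_pos
  have h1 := Stirling.tendsto_stirlingSeq_sqrt_pi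
  have h2 : Tendsto (fun k => Stirling.stirlingSeq (2 * k)) atTop (nhds √Real.pi) :=
    h1.comp (tendsto_id.const_mul_atTop' two_pos)
  have h := ((h2.pow 2).div (h1.pow 3) (by positivity)).mul_const √Real.pi
  rw [show √Real.pi ^ 2 / √Real.pi ^ 3 * √Real.pi = 1 by field_simp] at h
  refine h.congr' ?_
  filter_upwards [eventually_gt_atTop 0] with k hk
  exact (tripleQuotient_div_eq hk).symm

lemma pav_of_odd {n : ℕ} (hn : Odd n) : pav n = 0 := by
  rw [pav, Nat.card_eq_zero]
  left
  refine ⟨fun q => ?_⟩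
  obtain ⟨t, -⟩ := Quot.exists_rep q
  have := t.2.1.1.even_card
  rw [Fintype.card_fin] at this
  exact Nat.not_even_iff_odd.2 hn this

theorem pavings_asymptotics :
    (∀ n : ℕ, Odd n → pav n = 0) ∧
    Tendsto (fun k : ℕ =>
      (pav (2 * k) : ℝ) /
        (Real.sqrt (2 / Real.pi) * (2 / Real.exp 1) ^ k *
          (k : ℝ) ^ ((k : ℝ) - 1 / 2)))
      atTop (nhds 1) := by
  refine ⟨fun n hn => pav_of_odd hn, ?_⟩
  have h := tendsto_pav_div_tripleQuotient.mul tendsto_tripleQuotient_div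
  rw [one_mul] at h
  refine h.congr fun k => ?_
  exact div_mul_div_cancel₀ (tripleQuotient_pos k).ne'
end

section
/- For every n ≥ 1 and for each generator g ∈ {a, b, c} of Δ⁺ = ℤ/2 * ℤ/2 * ℤ/2, and every free subgroup H ≤ Δ⁺ of index n, the permutation induced by g on the n cosets of H is a fixed-point-free involution; moreover the action of Δ⁺ on the cosets of H is transitive, so the triple of permutations induced by (a, b, c) on the coset space is a transitive triple of fixed-point-free involutions on a set of n elements. -/
/-- `Δ⁺ = ℤ/2 * ℤ/2 * ℤ/2`, the free product of three copies of the cyclic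
group of order two. -/
abbrev Delta : Type := Monoid.CoprodI (fun _ : Fin 3 => Multiplicative (ZMod 2))

/-- The canonical generator `a` of the first free factor. -/
def genA : Delta :=
  Monoid.CoprodI.of (i := (0 : Fin 3)) (Multiplicative.ofAdd (1 : ZMod 2))

/-- The canonical generator `b` of the second free factor. -/
def genB : Delta :=
  Monoid.CoprodI.of (i := (1 : Fin 3)) (Multiplicative.ofAdd (1 : ZMod 2))

/-- The canonical generator `c` of the third free factor. -/
def genC : Delta :=
  Monoid.CoprodI.of (i := (2 : Fin 3)) (Multiplicative.ofAdd (1 : ZMod 2))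

theorem IsFreeGroup.isMulTorsionFree (G : Type*) [Group G] [IsFreeGroup G] :
    IsMulTorsionFree G :=
  (IsFreeGroup.toFreeGroup G).injective.isMulTorsionFree (IsFreeGroup.toFreeGroup G).toMonoidHom

/-- A nontrivial element of finite order acts without fixed points on the cosets of a torsion-free
subgroup. -/
theorem Subgroup.smul_quotient_ne_of_pow_eq_one {G : Type*} [Group G] (H : Subgroup G)
    [IsMulTorsionFree H] {g : G} (hg : g ≠ 1) {k : ℕ} (hk : k ≠ 0) (hgk : g ^ k = 1)
    (x : G ⧸ H) : g • x ≠ x := by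
  induction x using QuotientGroup.induction_on with | _ w =>
  intro h
  have hmem : w⁻¹ * g * w ∈ H := by
    have := QuotientGroup.eq.mp h.symm
    simpa [mul_assoc] using this
  have hpow : (⟨w⁻¹ * g * w, hmem⟩ : H) ^ k = 1 := by
    ext
    simpa [hgk] using conj_pow (i := k) (a := w⁻¹) (b := g)
  have h1 := congrArg Subtype.val ((pow_eq_one_iff_left hk).mp hpow)
  simp only [Subgroup.coe_one] at h1
  apply hg
  calc g = w * (w⁻¹ * g * w) * w⁻¹ := by group
    _ = 1 := by rw [h1]; group

/-- The free product of three copies of `ℤ/2` is generated by its canonical involutions. -/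
theorem closure_genA_genB_genC : Subgroup.closure ({genA, genB, genC} : Set Delta) = ⊤ := by
  refine (Subgroup.eq_top_iff' _).mpr fun x => ?_
  induction x using Monoid.CoprodI.induction_on with
  | one => exact one_mem _
  | mul x y hx hy => exact mul_mem hx hy
  | of i m =>
    have hm : m = 1 ∨ m = Multiplicative.ofAdd (1 : ZMod 2) := by
      revert m; decide
    rcases hm with rfl | rfl
    · simp
    · apply Subgroup.subset_closure
      fin_cases i
      · exact Or.inl rfl
      · exact Or.inr (Or.inl rfl)
      · exact Or.inr (Or.inr rfl)

theorem Delta.of_sq (i : Fin 3) (m : Multiplicative (ZMod 2)) :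
    (Monoid.CoprodI.of (i := i) m : Delta) ^ 2 = 1 := by
  rw [← map_pow, show m ^ 2 = 1 by revert m; decide, map_one]

theorem Delta.of_ofAdd_one_ne_one (i : Fin 3) :
    (Monoid.CoprodI.of (i := i) (Multiplicative.ofAdd (1 : ZMod 2)) : Delta) ≠ 1 :=
  fun h => absurd (Monoid.CoprodI.of_injective i (h.trans (map_one _).symm)) (by decide)

theorem sq_eq_one_and_ne_one_of_mem_generators {g : Delta}
    (hg : g ∈ ({genA, genB, genC} : Set Delta)) : g ^ 2 = 1 ∧ g ≠ 1 := by
  rcases hg with rfl | rfl | rfl <;>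
    exact ⟨Delta.of_sq _ _, Delta.of_ofAdd_one_ne_one _⟩

theorem free_subgroup_gives_transitive_triple
    (n : ℕ) (hn : 1 ≤ n) (H : Subgroup Delta) (hidx : H.index = n)
    (hfree : IsFreeGroup H) :
    -- the coset space has `n` elements
    Nat.card (Delta ⧸ H) = n ∧
    -- each generator induces a fixed-point-free involution on the cosets
    (∀ g ∈ ({genA, genB, genC} : Set Delta),
      IsFPFInvolution (MulAction.toPermHom Delta (Delta ⧸ H) g)) ∧
    -- the action of `Δ⁺` on the cosets is transitive
    (∀ x y : Delta ⧸ H, ∃ g : Delta, g • x = y) ∧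
    -- hence the triple of induced permutations is a transitive triple of
    -- fixed-point-free involutions on the coset space
    (∀ x y : Delta ⧸ H,
      ∃ π ∈ Subgroup.closure
        ({MulAction.toPermHom Delta (Delta ⧸ H) genA,
          MulAction.toPermHom Delta (Delta ⧸ H) genB,
          MulAction.toPermHom Delta (Delta ⧸ H) genC} :
            Set (Equiv.Perm (Delta ⧸ H))), π x = y) := by
  have : IsMulTorsionFree H := IsFreeGroup.isMulTorsionFree H
  refine ⟨hidx, fun g hg => ?_, MulAction.exists_smul_eq Delta, fun x y => ?_⟩
  · obtain ⟨hsq, hne⟩ := sq_eq_one_and_ne_one_of_mem_generators hg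
    exact ⟨by rw [← map_mul, ← sq, hsq, map_one],
      H.smul_quotient_ne_of_pow_eq_one hne two_ne_zero hsq⟩
  · obtain ⟨g, rfl⟩ := MulAction.exists_smul_eq Delta x y
    refine ⟨MulAction.toPermHom Delta (Delta ⧸ H) g, ?_, rfl⟩
    have hmem : g ∈ Subgroup.closure ({genA, genB, genC} : Set Delta) :=
      closure_genA_genB_genC ▸ Subgroup.mem_top g
    have := Subgroup.mem_map_of_mem (MulAction.toPermHom Delta (Delta ⧸ H)) hmem
    rwa [MonoidHom.map_closure, Set.image_insert_eq, Set.image_pair] at this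
end
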